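/- arXiv:2112.09901 — 10 statements merged into one kernel-verified Lean document; each statement's English description precedes it below -/
import Mathlib

section
/- Let H be a real Hilbert space, C a nonempty closed convex subset of H, f : C × C → ℝ a bifunction satisfying conditions (A1)–(A4), r > 0 and x ∈ H. If z₁ ∈ T_r(x) and z₂ ∈ T_r(x), then z₁ = z₂; that is, the resolvent set T_r(x) contains at most one point. -/
open scoped RealInnerProductSpace

/-- the resolvent set `T_r(x)` of a bifunction satisfying (A1)–(A4) contains
at most one point. -/
theorem statement2 (H : Type*) [NormedAddCommGroup H] [InnerProductSpace ℝ H] [CompleteSpace H]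
    (C : Set H) (hCne : C.Nonempty) (hCclosed : IsClosed C) (hCconv : Convex ℝ C)
    (f : H → H → ℝ)
    (hA1 : ∀ x ∈ C, f x x = 0)
    (hA2 : ∀ x ∈ C, ∀ y ∈ C, f x y + f y x ≤ 0)
    (hA3 : ∀ x ∈ C, ∀ y ∈ C, ∀ z ∈ C,
      Filter.limsup (fun t : ℝ => f (t • z + (1 - t) • x) y) (nhdsWithin 0 (Set.Ioi 0)) ≤ f x y)
    (hA4 : ∀ x ∈ C, ConvexOn ℝ C (f x) ∧ LowerSemicontinuousOn (f x) C)
    (r : ℝ) (hr : 0 < r) (x : H) (z₁ z₂ : H)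
    (hz₁ : z₁ ∈ C ∧ ∀ y ∈ C, 0 ≤ f z₁ y + (1 / r) * ⟪y - z₁, z₁ - x⟫)
    (hz₂ : z₂ ∈ C ∧ ∀ y ∈ C, 0 ≤ f z₂ y + (1 / r) * ⟪y - z₂, z₂ - x⟫) :
    z₁ = z₂ := by
  obtain ⟨hz₁C, h₁⟩ := hz₁
  obtain ⟨hz₂C, h₂⟩ := hz₂
  have key : ⟪z₂ - z₁, z₁ - x⟫ + ⟪z₁ - z₂, z₂ - x⟫ = -⟪z₁ - z₂, z₁ - z₂⟫ := by
    simp only [inner_sub_left, inner_sub_right]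
    ring
  have hsum : 0 ≤ (1 / r) * -⟪z₁ - z₂, z₁ - z₂⟫ := by
    rw [← key, mul_add]
    linarith [h₁ z₂ hz₂C, h₂ z₁ hz₁C, hA2 z₁ hz₁C z₂ hz₂C]
  have hle : ⟪z₁ - z₂, z₁ - z₂⟫ ≤ 0 :=
    neg_nonneg.mp (nonneg_of_mul_nonneg_right hsum (one_div_pos.mpr hr))
  exact sub_eq_zero.mp (inner_self_eq_zero.mp (le_antisymm hle real_inner_self_nonneg))
end

section
/- Let H be a real Hilbert space, C a nonempty closed convex subset of H, f : C × C → ℝ a bifunction satisfying conditions (A1)–(A4), and r > 0. If x, y ∈ H, z_x ∈ T_r(x) and z_y ∈ T_r(y), then ‖z_x − z_y‖² ≤ ⟨x − y, z_x − z_y⟩ (firm nonexpansiveness of the equilibrium resolvent). -/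
open scoped RealInnerProductSpace

/-- firm nonexpansiveness of the equilibrium resolvent: if `z_x ∈ T_r(x)` and
`z_y ∈ T_r(y)` then `‖z_x - z_y‖² ≤ ⟨x - y, z_x - z_y⟩`. -/
theorem statement3 (H : Type*) [NormedAddCommGroup H] [InnerProductSpace ℝ H] [CompleteSpace H]
    (C : Set H) (hCne : C.Nonempty) (hCclosed : IsClosed C) (hCconv : Convex ℝ C)
    (f : H → H → ℝ)
    (hA1 : ∀ x ∈ C, f x x = 0)
    (hA2 : ∀ x ∈ C, ∀ y ∈ C, f x y + f y x ≤ 0)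
    (hA3 : ∀ x ∈ C, ∀ y ∈ C, ∀ z ∈ C,
      Filter.limsup (fun t : ℝ => f (t • z + (1 - t) • x) y) (nhdsWithin 0 (Set.Ioi 0)) ≤ f x y)
    (hA4 : ∀ x ∈ C, ConvexOn ℝ C (f x) ∧ LowerSemicontinuousOn (f x) C)
    (r : ℝ) (hr : 0 < r) (x y : H) (zx zy : H)
    (hzx : zx ∈ C ∧ ∀ w ∈ C, 0 ≤ f zx w + (1 / r) * ⟪w - zx, zx - x⟫)
    (hzy : zy ∈ C ∧ ∀ w ∈ C, 0 ≤ f zy w + (1 / r) * ⟪w - zy, zy - y⟫) :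
    ‖zx - zy‖ ^ 2 ≤ ⟪x - y, zx - zy⟫ := by
  have h_sum : 0 ≤ (1 / r) * (⟪zy - zx, zx - x⟫ + ⟪zx - zy, zy - y⟫) := by
    linarith [hzx.2 zy hzy.1, hzy.2 zx hzx.1, hA2 zx hzx.1 zy hzy.1]
  have h_nonneg := nonneg_of_mul_nonneg_right h_sum (one_div_pos.mpr hr)
  have h_eq : ⟪zy - zx, zx - x⟫ + ⟪zx - zy, zy - y⟫ = ⟪x - y, zx - zy⟫ - ‖zx - zy‖ ^ 2 := by
    rw [← real_inner_self_eq_norm_sq, ← neg_sub zx zy, inner_neg_left, ← inner_neg_right,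
      ← inner_add_right, real_inner_comm (zx - zy) (x - y), ← inner_sub_right]
    congr 1
    abel
  linarith
end

section
/- Let H be a real Hilbert space, C a nonempty closed convex subset of H, f : C × C → ℝ a bifunction satisfying conditions (A1)–(A4), r > 0 and x ∈ H. If p ∈ EP(f) and z ∈ T_r(x), then ‖p − z‖² + ‖z − x‖² ≤ ‖p − x‖². -/
open scoped RealInnerProductSpace

/-- if `p ∈ EP(f)` and `z ∈ T_r(x)` then `‖p - z‖² + ‖z - x‖² ≤ ‖p - x‖²`. -/
theorem statement4 (H : Type*) [NormedAddCommGroup H] [InnerProductSpace ℝ H] [CompleteSpace H]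
    (C : Set H) (hCne : C.Nonempty) (hCclosed : IsClosed C) (hCconv : Convex ℝ C)
    (f : H → H → ℝ)
    (hA1 : ∀ x ∈ C, f x x = 0)
    (hA2 : ∀ x ∈ C, ∀ y ∈ C, f x y + f y x ≤ 0)
    (hA3 : ∀ x ∈ C, ∀ y ∈ C, ∀ z ∈ C,
      Filter.limsup (fun t : ℝ => f (t • z + (1 - t) • x) y) (nhdsWithin 0 (Set.Ioi 0)) ≤ f x y)
    (hA4 : ∀ x ∈ C, ConvexOn ℝ C (f x) ∧ LowerSemicontinuousOn (f x) C)
    (r : ℝ) (hr : 0 < r) (x : H) (p z : H)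
    (hp : p ∈ C ∧ ∀ y ∈ C, 0 ≤ f p y)
    (hz : z ∈ C ∧ ∀ y ∈ C, 0 ≤ f z y + (1 / r) * ⟪y - z, z - x⟫) :
    ‖p - z‖ ^ 2 + ‖z - x‖ ^ 2 ≤ ‖p - x‖ ^ 2 := by
  have hinner : 0 ≤ ⟪p - z, z - x⟫ := by
    have h : 0 ≤ (1 / r) * ⟪p - z, z - x⟫ := by
      linarith [hz.2 p hp.1, hp.2 z hz.1, hA2 p hp.1 z hz.1]
    exact nonneg_of_mul_nonneg_right h (one_div_pos.mpr hr)
  have hsq := norm_add_sq_real (p - z) (z - x)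
  rw [sub_add_sub_cancel] at hsq
  linarith
end

section
/- Let H be a real Hilbert space, C a nonempty closed convex subset of H, and A : C → H a continuous monotone map. Then for every r > 0 and every x ∈ H, the set F_r(x) contains exactly one point; that is, there exists a unique z ∈ C such that ⟨y − z, Az⟩ + (1/r)⟨y − z, z − x⟩ ≥ 0 for all y ∈ C. -/
open scoped RealInnerProductSpace

open Filter Topology in
/-- A family of closed convex sets in a Hilbert space with the finite intersection property, one of
which is bounded, has a common point. -/
theorem iInter_nonempty_of_closed_convex_bounded {ι H : Type*} [NormedAddCommGroup H]
    [InnerProductSpace ℝ H] [CompleteSpace H] (G : ι → Set H) (hclosed : ∀ i, IsClosed (G i))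
    (hconv : ∀ i, Convex ℝ (G i)) (i₀ : ι) (hbdd : Bornology.IsBounded (G i₀))
    (hfin : ∀ s : Finset ι, (G i₀ ∩ ⋂ i ∈ s, G i).Nonempty) :
    (⋂ i, G i).Nonempty := by
  classical
  set K : Finset ι → Set H := fun s => G i₀ ∩ ⋂ i ∈ s, G i with hK
  have hKclosed (s) : IsClosed (K s) :=
    (hclosed i₀).inter (isClosed_biInter fun i _ => hclosed i)
  have hKconv (s) : Convex ℝ (K s) := (hconv i₀).inter (convex_iInter₂ fun i _ => hconv i)
  have hKanti {s t : Finset ι} (hst : s ⊆ t) : K t ⊆ K s :=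
    Set.inter_subset_inter_right _ (Set.biInter_subset_biInter_left hst)
  have hmin (s) : ∃ p ∈ K s, ∀ w ∈ K s, ⟪(0 : H) - p, w - p⟫ ≤ 0 := by
    obtain ⟨p, hp, hp'⟩ := exists_norm_eq_iInf_of_complete_convex (hfin s)
      (hKclosed s).isComplete (hKconv s) 0
    exact ⟨p, hp, (norm_eq_iInf_iff_real_inner_le_zero (hKconv s) hp).1 hp'⟩
  choose p hp hpmin using hmin
  have hdist {s t : Finset ι} (hst : s ⊆ t) : ‖p t - p s‖ ^ 2 ≤ ‖p t‖ ^ 2 - ‖p s‖ ^ 2 := by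
    have h := hpmin s (p t) (hKanti hst (hp t))
    rw [zero_sub, inner_neg_left, inner_sub_right, real_inner_self_eq_norm_sq] at h
    rw [norm_sub_sq_real, real_inner_comm]
    linarith
  obtain ⟨R, hR⟩ := hbdd.exists_norm_le
  have hmono : Monotone fun s => ‖p s‖ ^ 2 := fun s t hst => by
    have := hdist hst
    have := sq_nonneg ‖p t - p s‖
    simp only
    linarith
  have hbound : BddAbove (Set.range fun s => ‖p s‖ ^ 2) := by
    refine ⟨R ^ 2, ?_⟩
    rintro _ ⟨s, rfl⟩
    exact pow_le_pow_left₀ (norm_nonneg _) (hR _ (hp s).1) 2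
  have hcauchyN : CauchySeq fun s => ‖p s‖ ^ 2 := (tendsto_atTop_ciSup hmono hbound).cauchySeq
  have hcauchy : CauchySeq p := by
    rw [Metric.cauchySeq_iff'] at hcauchyN ⊢
    intro ε hε
    obtain ⟨s, hs⟩ := hcauchyN (ε ^ 2) (by positivity)
    refine ⟨s, fun t hst => ?_⟩
    have h1 := hs t hst
    rw [Real.dist_eq] at h1
    have h2 := (le_abs_self _).trans_lt h1
    rw [dist_eq_norm]
    exact lt_of_pow_lt_pow_left₀ 2 hε.le ((hdist hst).trans_lt h2)
  obtain ⟨z, hz⟩ := cauchySeq_tendsto_of_complete hcauchy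
  refine ⟨z, Set.mem_iInter.2 fun i => (hclosed i).mem_of_tendsto hz ?_⟩
  filter_upwards [eventually_ge_atTop {i}] with s hs
  exact Set.mem_iInter₂.1 (hp s).2 i (hs (Finset.mem_singleton_self i))

/-- If every convex combination of finitely many continuous concave functions is nonnegative
somewhere on a compact convex set, then the functions are simultaneously nonnegative somewhere. -/
theorem exists_forall_nonneg_of_concaveOn {ι E : Type*} [Fintype ι] [AddCommGroup E] [Module ℝ E]
    [TopologicalSpace E] [IsTopologicalAddGroup E] [ContinuousSMul ℝ E] {K : Set E}
    (hKne : K.Nonempty) (hK : IsCompact K) (hKconv : Convex ℝ K) (g : ι → E → ℝ)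
    (hg : ∀ i, ConcaveOn ℝ K (g i)) (hgc : ∀ i, ContinuousOn (g i) K)
    (h : ∀ w ∈ stdSimplex ℝ ι, ∃ z ∈ K, 0 ≤ ∑ i, w i * g i z) :
    ∃ z ∈ K, ∀ i, 0 ≤ g i z := by
  classical
  by_contra! hneg
  have hlin (z : E) : IsLinearMap ℝ fun w : ι → ℝ => ∑ i, w i * -g i z :=
    ⟨fun v w => by simp [add_mul, Finset.sum_add_distrib, add_comm],
      fun a w => by simp [Finset.mul_sum, mul_assoc]⟩
  obtain ⟨w, hw, hwK⟩ := Sion.exists_lt_iInf_of_lt_iInf_of_finite (X := K) (Y := stdSimplex ℝ ι)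
    (f := fun z w => ∑ i, w i * -g i z) (s := Set.range fun i => Pi.single i (1 : ℝ)) (t := 0)
    hKne hK
    (fun w _ => ContinuousOn.lowerSemicontinuousOn
      (continuousOn_finsetSum _ fun i _ => continuousOn_const.mul (hgc i).neg))
    (fun w hw => ConvexOn.quasiconvexOn (by
      refine ⟨hKconv, fun x hx y hy a b ha hb hab => ?_⟩
      simp only [smul_eq_mul, Finset.mul_sum, ← Finset.sum_add_distrib]
      refine Finset.sum_le_sum fun i _ => ?_
      have h1 := (hg i).2 hx hy ha hb hab
      simp only [smul_eq_mul] at h1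
      nlinarith [mul_le_mul_of_nonneg_left h1 (hw.1 i)]))
    (convex_stdSimplex ℝ ι)
    (fun z _ => ContinuousOn.upperSemicontinuousOn (by fun_prop))
    (fun z _ => ((hlin z).mk' _).concaveOn (convex_stdSimplex ℝ ι) |>.quasiconcaveOn)
    hKconv (Set.finite_range _)
    (by rintro _ ⟨i, rfl⟩; exact single_mem_stdSimplex ℝ i)
    (fun z hz => by
      obtain ⟨i, hi⟩ := hneg z hz
      refine ⟨_, ⟨i, rfl⟩, ?_⟩
      simpa [Pi.single_apply] using hi)
  obtain ⟨z, hz, hz0⟩ := h w hw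
  have := hwK z hz
  simp only [mul_neg, Finset.sum_neg_distrib] at this
  linarith

section Minty

variable {H : Type*} [NormedAddCommGroup H] [InnerProductSpace ℝ H]

theorem concaveOn_inner_add_mul_inner (s : Set H) (hs : Convex ℝ s) {c : ℝ} (hc : 0 ≤ c)
    (x y a : H) : ConcaveOn ℝ s fun z => ⟪y - z, a⟫ + c * ⟪y - z, z - x⟫ := by
  refine ⟨hs, fun u _ v _ α β hα hβ hαβ => ?_⟩
  obtain rfl : β = 1 - α := by linarith
  have key : 0 ≤ c * (α * (1 - α) * ⟪u - v, u - v⟫) :=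
    mul_nonneg hc (mul_nonneg (mul_nonneg hα hβ) real_inner_self_nonneg)
  simp only [inner_sub_left, inner_sub_right, inner_add_left, inner_add_right,
    real_inner_smul_left, real_inner_smul_right, smul_eq_mul, real_inner_comm u v] at key ⊢
  nlinarith [key]

theorem isBounded_setOf_inner_add_mul_inner_nonneg {c : ℝ} (hc : 0 < c) (x y a : H) :
    Bornology.IsBounded {z : H | 0 ≤ ⟪y - z, a⟫ + c * ⟪y - z, z - x⟫} := by
  refine (Metric.isBounded_closedBall (x := y) (r := ‖a + c • (y - x)‖ / c)).subset fun z hz => ?_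
  rw [mem_closedBall_iff_norm', le_div_iff₀ hc]
  have h1 : ⟪y - z, a⟫ + c * ⟪y - z, z - x⟫
      = ⟪y - z, a + c • (y - x)⟫ - c * ‖y - z‖ ^ 2 := by
    rw [← real_inner_self_eq_norm_sq, inner_add_right, real_inner_smul_right,
      show z - x = (y - x) - (y - z) by abel, inner_sub_right _ (y - x)]
    ring
  have h2 := real_inner_le_norm (y - z) (a + c • (y - x))
  rw [Set.mem_ofPred_eq, h1] at hz
  rcases (norm_nonneg (y - z)).eq_or_lt with h0 | h0
  · rw [← h0]; simp
  · refine le_of_mul_le_mul_left ?_ h0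
    linarith

/-- The weighted average of the Minty functionals of a monotone map at points `y i` is nonnegative
at the corresponding weighted average of these points. -/
theorem sum_mul_inner_nonneg_of_monotone {ι : Type*} [Fintype ι] (y a : ι → H)
    (hmono : ∀ i j, 0 ≤ ⟪y i - y j, a i - a j⟫) (c : ℝ) (x : H) (w : ι → ℝ)
    (hw : w ∈ stdSimplex ℝ ι) :
    0 ≤ ∑ i, w i * (⟪y i - ∑ j, w j • y j, a i⟫
      + c * ⟪y i - ∑ j, w j • y j, (∑ j, w j • y j) - x⟫) := by
  set z := ∑ j, w j • y j with hz
  have hzero : ∑ i, w i • (y i - z) = 0 := by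
    simp only [smul_sub, Finset.sum_sub_distrib, ← Finset.sum_smul, hw.2, one_smul]
    rw [← hz, sub_self]
  have h2 : ∑ i, w i * (c * ⟪y i - z, z - x⟫) = 0 := by
    have : ∑ i, w i * (c * ⟪y i - z, z - x⟫) = c * ⟪∑ i, w i • (y i - z), z - x⟫ := by
      rw [sum_inner, Finset.mul_sum]
      exact Finset.sum_congr rfl fun i _ => by rw [real_inner_smul_left]; ring
    rw [this, hzero, inner_zero_left, mul_zero]
  have h1 : ∑ i, w i * ⟪y i - z, a i⟫ = ∑ i, ∑ j, w i * w j * ⟪y i - y j, a i⟫ := by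
    refine Finset.sum_congr rfl fun i _ => ?_
    have : y i - z = ∑ j, w j • (y i - y j) := by
      simp only [smul_sub, Finset.sum_sub_distrib, ← Finset.sum_smul, hw.2, one_smul, hz]
    rw [this, sum_inner, Finset.mul_sum]
    exact Finset.sum_congr rfl fun j _ => by rw [real_inner_smul_left]; ring
  have h3 : 0 ≤ ∑ i, ∑ j, w i * w j * ⟪y i - y j, a i - a j⟫ :=
    Finset.sum_nonneg fun i _ => Finset.sum_nonneg fun j _ =>
      mul_nonneg (mul_nonneg (hw.1 i) (hw.1 j)) (hmono i j)
  have h4 : ∑ i, ∑ j, w i * w j * ⟪y i - y j, a i - a j⟫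
      = 2 * ∑ i, ∑ j, w i * w j * ⟪y i - y j, a i⟫ := by
    have hswap : ∑ i, ∑ j, w i * w j * ⟪y i - y j, a j⟫
        = -∑ i, ∑ j, w i * w j * ⟪y i - y j, a i⟫ := by
      rw [Finset.sum_comm]
      simp only [← Finset.sum_neg_distrib]
      refine Finset.sum_congr rfl fun i _ => Finset.sum_congr rfl fun j _ => ?_
      rw [← neg_sub (y i) (y j), inner_neg_left]
      ring
    simp only [inner_sub_right (_ - _), mul_sub, Finset.sum_sub_distrib] at hswap ⊢
    rw [hswap]
    ring
  simp only [mul_add, Finset.sum_add_distrib] at *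
  rw [h1, h2]
  linarith

/-- The Minty form of the regularized variational inequality for a monotone map is solvable. -/
theorem exists_forall_inner_add_mul_inner_nonneg [CompleteSpace H] {C : Set H}
    (hCne : C.Nonempty) (hCclosed : IsClosed C) (hCconv : Convex ℝ C) (A : H → H)
    (hAmono : ∀ u ∈ C, ∀ v ∈ C, 0 ≤ ⟪u - v, A u - A v⟫) {c : ℝ} (hc : 0 < c) (x : H) :
    ∃ z ∈ C, ∀ y ∈ C, 0 ≤ ⟪y - z, A y⟫ + c * ⟪y - z, z - x⟫ := by
  classical
  obtain ⟨y₀, hy₀⟩ := hCne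
  let g : H → H → ℝ := fun y z => ⟪y - z, A y⟫ + c * ⟪y - z, z - x⟫
  have hgcont (y) : Continuous (g y) := by fun_prop
  have hfin (s : Finset C) : ∃ z ∈ C, ∀ y ∈ s, 0 ≤ g y z := by
    rcases s.eq_empty_or_nonempty with rfl | ⟨y₁, hy₁⟩
    · exact ⟨y₀, hy₀, by simp⟩
    let v : s → H := fun i => i.1.1
    have hsub : convexHull ℝ (Set.range v) ⊆ C :=
      convexHull_min (by rintro _ ⟨i, rfl⟩; exact i.1.2) hCconv
    obtain ⟨z, hz, hz'⟩ := exists_forall_nonneg_of_concaveOn (K := convexHull ℝ (Set.range v))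
      ⟨_, subset_convexHull ℝ _ ⟨⟨y₁, hy₁⟩, rfl⟩⟩ ((Set.finite_range v).isCompact_convexHull ℝ)
      (convex_convexHull ℝ _) (fun i => g (v i))
      (fun i => concaveOn_inner_add_mul_inner _ (convex_convexHull ℝ _) hc.le _ _ _)
      (fun i => (hgcont _).continuousOn)
      (fun w hw => ⟨∑ i, w i • v i,
        (convex_convexHull ℝ _).sum_mem (fun i _ => hw.1 i) hw.2
          (fun i _ => subset_convexHull ℝ _ ⟨i, rfl⟩),
        sum_mul_inner_nonneg_of_monotone v (fun i => A (v i))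
          (fun i j => hAmono _ i.1.2 _ j.1.2) c x w hw⟩)
    exact ⟨z, hsub hz, fun y hy => hz' ⟨y, hy⟩⟩
  obtain ⟨z, hz⟩ := iInter_nonempty_of_closed_convex_bounded
    (fun y : C => {z | z ∈ C ∧ 0 ≤ g y z})
    (fun y => hCclosed.inter (isClosed_le continuous_const (hgcont y)))
    (fun y => (concaveOn_inner_add_mul_inner C hCconv hc.le x y (A y)).convex_ge 0)
    ⟨y₀, hy₀⟩
    ((isBounded_setOf_inner_add_mul_inner_nonneg hc x y₀ (A y₀)).subset fun z hz => hz.2)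
    (fun s => by
      obtain ⟨z, hzC, hz⟩ := hfin (insert ⟨y₀, hy₀⟩ s)
      refine ⟨z, ⟨hzC, hz _ (Finset.mem_insert_self _ _)⟩, Set.mem_iInter₂.2 fun i hi => ?_⟩
      exact ⟨hzC, hz i (Finset.mem_insert_of_mem hi)⟩)
  rw [Set.mem_iInter] at hz
  exact ⟨z, (hz ⟨y₀, hy₀⟩).1, fun y hy => (hz ⟨y, hy⟩).2⟩

open Filter Topology in
/-- **Minty's lemma** for the regularized variational inequality. -/
theorem inner_add_mul_inner_nonneg_of_minty {C : Set H} (hCconv : Convex ℝ C) {A : H → H}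
    (hAcont : ContinuousOn A C) {c : ℝ} {x z : H} (hz : z ∈ C)
    (h : ∀ y ∈ C, 0 ≤ ⟪y - z, A y⟫ + c * ⟪y - z, z - x⟫) {y : H} (hy : y ∈ C) :
    0 ≤ ⟪y - z, A z⟫ + c * ⟪y - z, z - x⟫ := by
  have hmem {t : ℝ} (ht : t ∈ Set.Ioo (0 : ℝ) 1) : z + t • (y - z) ∈ C :=
    hCconv.add_smul_sub_mem hz hy ⟨ht.1.le, ht.2.le⟩
  have hev : ∀ᶠ t : ℝ in 𝓝[>] 0, t ∈ Set.Ioo (0 : ℝ) 1 := Ioo_mem_nhdsGT one_pos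
  have hpath : Tendsto (fun t : ℝ => z + t • (y - z)) (𝓝[>] 0) (𝓝[C] z) := by
    refine tendsto_nhdsWithin_iff.2 ⟨?_, hev.mono fun t ht => hmem ht⟩
    have : Continuous fun t : ℝ => z + t • (y - z) := by fun_prop
    simpa using (this.tendsto 0).mono_left nhdsWithin_le_nhds
  have hlim : Tendsto (fun t : ℝ => ⟪y - z, A (z + t • (y - z))⟫ + c * ⟪y - z, z - x⟫) (𝓝[>] 0)
      (𝓝 (⟪y - z, A z⟫ + c * ⟪y - z, z - x⟫)) :=
    (tendsto_const_nhds.inner ((hAcont z hz).tendsto.comp hpath)).add_const _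
  refine ge_of_tendsto hlim (hev.mono fun t ht => ?_)
  have h1 := h _ (hmem ht)
  rw [add_sub_cancel_left, real_inner_smul_left, real_inner_smul_left] at h1
  refine nonneg_of_mul_nonneg_right (a := t) ?_ ht.1
  linarith

end Minty

/-- for a continuous monotone map `A : C → H`, every `r > 0` and `x ∈ H`, the
resolvent set `F_r(x)` contains exactly one point: there is a unique `z ∈ C` with
`⟨y - z, Az⟩ + (1/r)⟨y - z, z - x⟩ ≥ 0` for all `y ∈ C`. -/
theorem statement6 (H : Type*) [NormedAddCommGroup H] [InnerProductSpace ℝ H] [CompleteSpace H]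
    (C : Set H) (hCne : C.Nonempty) (hCclosed : IsClosed C) (hCconv : Convex ℝ C)
    (A : H → H) (hAcont : ContinuousOn A C)
    (hAmono : ∀ u ∈ C, ∀ v ∈ C, 0 ≤ ⟪u - v, A u - A v⟫)
    (r : ℝ) (hr : 0 < r) (x : H) :
    ∃! z, z ∈ C ∧ ∀ y ∈ C, 0 ≤ ⟪y - z, A z⟫ + (1 / r) * ⟪y - z, z - x⟫ := by
  have hc : 0 < 1 / r := by positivity
  obtain ⟨z, hz, hmin⟩ :=
    exists_forall_inner_add_mul_inner_nonneg hCne hCclosed hCconv A hAmono hc x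
  have hzsol : ∀ y ∈ C, 0 ≤ ⟪y - z, A z⟫ + (1 / r) * ⟪y - z, z - x⟫ :=
    fun y hy => inner_add_mul_inner_nonneg_of_minty hCconv hAcont hz hmin hy
  refine ⟨z, ⟨hz, hzsol⟩, fun w ⟨hw, hwsol⟩ => ?_⟩
  have h1 := hzsol w hw
  have h2 := hwsol z hz
  have h3 := hAmono w hw z hz
  have h4 : (⟪w - z, A z⟫ + (1 / r) * ⟪w - z, z - x⟫) + (⟪z - w, A w⟫ + (1 / r) * ⟪z - w, w - x⟫)
      = -⟪w - z, A w - A z⟫ - (1 / r) * ‖w - z‖ ^ 2 := by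
    rw [← real_inner_self_eq_norm_sq]
    simp only [inner_sub_left, inner_sub_right]
    ring
  have h5 : (1 / r) * ‖w - z‖ ^ 2 ≤ 0 := by linarith
  have h6 : ‖w - z‖ ^ 2 ≤ 0 := nonpos_of_mul_nonpos_right h5 hc
  rw [← sub_eq_zero, ← norm_eq_zero]
  exact pow_eq_zero_iff two_ne_zero |>.1 (le_antisymm h6 (sq_nonneg _))
end

section
/- Let H be a real Hilbert space, C a nonempty closed convex subset of H, A : C → H a continuous monotone map, and r > 0. If x, y ∈ H, z_x ∈ F_r(x) and z_y ∈ F_r(y), then ‖z_x − z_y‖² ≤ ⟨x − y, z_x − z_y⟩ (firm nonexpansiveness of the variational-inequality resolvent). -/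
open scoped RealInnerProductSpace

/-- firm nonexpansiveness of the variational-inequality resolvent: if
`z_x ∈ F_r(x)` and `z_y ∈ F_r(y)` then `‖z_x - z_y‖² ≤ ⟨x - y, z_x - z_y⟩`. -/
theorem statement7 (H : Type*) [NormedAddCommGroup H] [InnerProductSpace ℝ H] [CompleteSpace H]
    (C : Set H) (hCne : C.Nonempty) (hCclosed : IsClosed C) (hCconv : Convex ℝ C)
    (A : H → H) (hAcont : ContinuousOn A C)
    (hAmono : ∀ u ∈ C, ∀ v ∈ C, 0 ≤ ⟪u - v, A u - A v⟫)
    (r : ℝ) (hr : 0 < r) (x y : H) (zx zy : H)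
    (hzx : zx ∈ C ∧ ∀ w ∈ C, 0 ≤ ⟪w - zx, A zx⟫ + (1 / r) * ⟪w - zx, zx - x⟫)
    (hzy : zy ∈ C ∧ ∀ w ∈ C, 0 ≤ ⟪w - zy, A zy⟫ + (1 / r) * ⟪w - zy, zy - y⟫) :
    ‖zx - zy‖ ^ 2 ≤ ⟪x - y, zx - zy⟫ := by
  have hx := hzx.2 zy hzy.1
  have hy := hzy.2 zx hzx.1
  have hA := hAmono zx hzx.1 zy hzy.1
  have hA' : ⟪zx - zy, A zx - A zy⟫ = -(⟪zy - zx, A zx⟫ + ⟪zx - zy, A zy⟫) := by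
    simp only [inner_sub_left, inner_sub_right]
    ring
  have hsum : 0 ≤ (1 / r) * (⟪zy - zx, zx - x⟫ + ⟪zx - zy, zy - y⟫) := by
    linarith
  have hnonneg := nonneg_of_mul_nonneg_right hsum (one_div_pos.mpr hr)
  have hS : ⟪zy - zx, zx - x⟫ + ⟪zx - zy, zy - y⟫ = ⟪x - y, zx - zy⟫ - ‖zx - zy‖ ^ 2 := by
    rw [← real_inner_self_eq_norm_sq, real_inner_comm (zx - zy) (x - y)]
    simp only [inner_sub_left, inner_sub_right]
    ring
  linarith
end

section
/- Let H be a real Hilbert space, C a nonempty closed convex subset of H, A : C → H a continuous monotone map, r > 0, and x ∈ H. If p ∈ VI(C,A) and z ∈ F_r(x), then ‖p − z‖² + ‖z − x‖² ≤ ‖p − x‖². -/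
open scoped RealInnerProductSpace

/-- if `p ∈ VI(C,A)` and `z ∈ F_r(x)` then `‖p - z‖² + ‖z - x‖² ≤ ‖p - x‖²`. -/
theorem statement8 (H : Type*) [NormedAddCommGroup H] [InnerProductSpace ℝ H] [CompleteSpace H]
    (C : Set H) (hCne : C.Nonempty) (hCclosed : IsClosed C) (hCconv : Convex ℝ C)
    (A : H → H) (hAcont : ContinuousOn A C)
    (hAmono : ∀ u ∈ C, ∀ v ∈ C, 0 ≤ ⟪u - v, A u - A v⟫)
    (r : ℝ) (hr : 0 < r) (x : H) (p z : H)
    (hp : p ∈ C ∧ ∀ y ∈ C, 0 ≤ ⟪y - p, A p⟫)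
    (hz : z ∈ C ∧ ∀ y ∈ C, 0 ≤ ⟪y - z, A z⟫ + (1 / r) * ⟪y - z, z - x⟫) :
    ‖p - z‖ ^ 2 + ‖z - x‖ ^ 2 ≤ ‖p - x‖ ^ 2 := by
  have h1 : ⟪p - z, A p⟫ ≤ 0 := by
    have h := hp.2 z hz.1
    rw [← neg_sub p z, inner_neg_left] at h
    linarith
  have h2 : ⟪p - z, A z⟫ ≤ ⟪p - z, A p⟫ := by
    have h := hAmono p hp.1 z hz.1
    rw [inner_sub_right] at h
    linarith
  have h3 : 0 ≤ ⟪p - z, z - x⟫ := by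
    have h := hz.2 p hp.1
    exact nonneg_of_mul_nonneg_right (by linarith) (one_div_pos.mpr hr)
  rw [← sub_add_sub_cancel p z x, norm_add_sq_real]
  linarith
end

section
/- Let H be a real Hilbert space and let u, x, z, w ∈ H satisfy ‖u − z‖ ≤ ‖u − x‖ and ‖u − w‖ ≤ ‖u − x‖. Let α₁, α₂, α₃ ∈ (0,1) with α₁ + α₂ + α₃ = 1 and set y = α₁x + α₂z + α₃w. Then ‖u − y‖² ≤ ‖u − x‖² − α₁α₃‖x − w‖². -/
open scoped RealInnerProductSpace

/-- The norm square of an affine combination of three vectors. -/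
theorem norm_sq_affine_combination_three {E : Type*} [NormedAddCommGroup E]
    [InnerProductSpace ℝ E] (a b c : E) {r s t : ℝ} (h : r + s + t = 1) :
    ‖r • a + s • b + t • c‖ ^ 2 = r * ‖a‖ ^ 2 + s * ‖b‖ ^ 2 + t * ‖c‖ ^ 2
      - r * s * ‖a - b‖ ^ 2 - s * t * ‖b - c‖ ^ 2 - r * t * ‖a - c‖ ^ 2 := by
  obtain rfl : r = 1 - s - t := by linarith
  simp only [← real_inner_self_eq_norm_sq, inner_add_left, inner_add_right, inner_sub_left,
    inner_sub_right, real_inner_smul_left, real_inner_smul_right]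
  rw [real_inner_comm a b, real_inner_comm a c, real_inner_comm b c]
  ring

/-- key inequality of Step 1, Hilbert-space setting: if `‖u - z‖ ≤ ‖u - x‖`
and `‖u - w‖ ≤ ‖u - x‖`, and `y = α₁x + α₂z + α₃w` with `α₁, α₂, α₃ ∈ (0,1)` summing to `1`,
then `‖u - y‖² ≤ ‖u - x‖² - α₁α₃‖x - w‖²`. -/
theorem statement11 (H : Type*) [NormedAddCommGroup H] [InnerProductSpace ℝ H] [CompleteSpace H]
    (u x z w : H)
    (hz : ‖u - z‖ ≤ ‖u - x‖) (hw : ‖u - w‖ ≤ ‖u - x‖)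
    (α₁ α₂ α₃ : ℝ)
    (hα₁ : α₁ ∈ Set.Ioo (0 : ℝ) 1) (hα₂ : α₂ ∈ Set.Ioo (0 : ℝ) 1)
    (hα₃ : α₃ ∈ Set.Ioo (0 : ℝ) 1) (hαsum : α₁ + α₂ + α₃ = 1)
    (y : H) (hy : y = α₁ • x + α₂ • z + α₃ • w) :
    ‖u - y‖ ^ 2 ≤ ‖u - x‖ ^ 2 - α₁ * α₃ * ‖x - w‖ ^ 2 := by
  have hcomb : u - y = α₁ • (u - x) + α₂ • (u - z) + α₃ • (u - w) := by
    obtain rfl : α₁ = 1 - α₂ - α₃ := by linarith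
    rw [hy]
    module
  have hz_sq : α₂ * ‖u - z‖ ^ 2 ≤ α₂ * ‖u - x‖ ^ 2 := by
    have := hα₂.1
    gcongr
  have hw_sq : α₃ * ‖u - w‖ ^ 2 ≤ α₃ * ‖u - x‖ ^ 2 := by
    have := hα₃.1
    gcongr
  have hxz : 0 ≤ α₁ * α₂ * ‖(u - x) - (u - z)‖ ^ 2 :=
    mul_nonneg (mul_pos hα₁.1 hα₂.1).le (sq_nonneg _)
  have hzw : 0 ≤ α₂ * α₃ * ‖(u - z) - (u - w)‖ ^ 2 :=
    mul_nonneg (mul_pos hα₂.1 hα₃.1).le (sq_nonneg _)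
  have hxw : ‖(u - x) - (u - w)‖ = ‖x - w‖ := by
    rw [sub_sub_sub_cancel_left, norm_sub_rev]
  have hsum : α₁ * ‖u - x‖ ^ 2 + α₂ * ‖u - x‖ ^ 2 + α₃ * ‖u - x‖ ^ 2 = ‖u - x‖ ^ 2 := by
    rw [← add_mul, ← add_mul, hαsum, one_mul]
  rw [hcomb, norm_sq_affine_combination_three _ _ _ hαsum, hxw]
  linarith
end

section
/- Let H be a real Hilbert space, C a nonempty closed convex subset of H, f₁,…,f_L : C × C → ℝ bifunctions satisfying conditions (A1)–(A4), A₁,…,A_N : C → H continuous monotone maps, and (T_n)_{n≥1} maps from C to H whose common fixed point set contains the set B := (⋂_n F(T_n)) ∩ (⋂_{l=1}^{L} EP(f_l)) ∩ (⋂_{k=1}^{N} VI(C,A_k)), assumed nonempty, and such that ‖T_n x − p‖ ≤ ‖x − p‖ for all x ∈ C, p ∈ B, n ≥ 1. Fix α₁, α₂, α₃ ∈ (0,1) with α₁+α₂+α₃ = 1, a > 0, r_n ≥ a, x = x₁ ∈ C, C₁ = C, and for n ≥ 1 let z_n ∈ C satisfy f_{n mod L}(z_n, y) + (1/r_n)⟨y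 − z_n, z_n − x_n⟩ ≥ 0 for all y ∈ C, let u_n ∈ C satisfy ⟨y − u_n, A_{n mod N} u_n⟩ + (1/r_n)⟨y − u_n, u_n − x_n⟩ ≥ 0 for all y ∈ C, let y_n = α₁x_n + α₂z_n + α₃T_n u_n, C_{n+1} = {z ∈ C_n : ‖z − y_n‖ ≤ ‖z − x_n‖}, and let x_{n+1} be the point of C_{n+1} nearest to x. Then B ⊆ C_n for every n ≥ 1; in particular each C_n is nonempty and the sequence (x_n) is well defined. -/
open scoped RealInnerProductSpace

/-- If the angle condition `0 ≤ ⟪p - z, z - w⟫` holds, then `z` is at least as close to `p`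
as `w` is. -/
lemma norm_sub_le_norm_sub_of_inner_nonneg {E : Type*} [NormedAddCommGroup E]
    [InnerProductSpace ℝ E] {p z w : E} (h : 0 ≤ ⟪p - z, z - w⟫) : ‖z - p‖ ≤ ‖w - p‖ := by
  have key := norm_add_sq_real (p - z) (z - w)
  rw [sub_add_sub_cancel] at key
  rw [norm_sub_rev z p, norm_sub_rev w p]
  refine le_of_sq_le_sq ?_ (norm_nonneg _)
  nlinarith [sq_nonneg ‖z - w‖]

/-- Resolvent-type estimate: the regularized inequality at `z`, tested at a point `p` where the
unregularized term is nonpositive, gives that `z` is at least as close to `p` as `w` is. -/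
lemma norm_sub_le_of_resolvent_ineq {E : Type*} [NormedAddCommGroup E] [InnerProductSpace ℝ E]
    {p z w : E} {r c : ℝ} (hr : 0 < r) (hc : c ≤ 0)
    (h : 0 ≤ c + (1 / r) * ⟪p - z, z - w⟫) : ‖z - p‖ ≤ ‖w - p‖ :=
  norm_sub_le_norm_sub_of_inner_nonneg
    (nonneg_of_mul_nonneg_right (by linarith) (one_div_pos.mpr hr))

/-- A closed ball is stable under convex combinations of three points. -/
lemma norm_convex_combination_sub_le {E : Type*} [NormedAddCommGroup E] [NormedSpace ℝ E]
    {α β γ R : ℝ} (hα : 0 ≤ α) (hβ : 0 ≤ β) (hγ : 0 ≤ γ) (hsum : α + β + γ = 1) {u v w p : E}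
    (hu : ‖u - p‖ ≤ R) (hv : ‖v - p‖ ≤ R) (hw : ‖w - p‖ ≤ R) :
    ‖α • u + β • v + γ • w - p‖ ≤ R := by
  have e : α • u + β • v + γ • w - p = α • (u - p) + β • (v - p) + γ • (w - p) := by
    have hp : p = (α + β + γ) • p := by rw [hsum, one_smul]
    nth_rewrite 1 [hp]
    module
  calc ‖α • u + β • v + γ • w - p‖ ≤ ‖α • (u - p)‖ + ‖β • (v - p)‖ + ‖γ • (w - p)‖ :=
        e ▸ norm_add₃_le
    _ = α * ‖u - p‖ + β * ‖v - p‖ + γ * ‖w - p‖ := by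
        rw [norm_smul_of_nonneg hα, norm_smul_of_nonneg hβ, norm_smul_of_nonneg hγ]
    _ ≤ α * R + β * R + γ * R := by gcongr
    _ = R := by rw [← add_mul, ← add_mul, hsum, one_mul]

/-- Step 1 of the main theorem, Hilbert-space setting; indices relabelled to
start at `0`: with `B` the intersection of the common fixed points of `(Tₙ)`, the equilibrium
solution sets of `f₁, …, f_L` and the variational-inequality solution sets of `A₁, …, A_N`,
assumed nonempty, and the hybrid sequences `xₙ, zₙ, uₙ, yₙ, Cₙ` as in the algorithm, one has
`B ⊆ Cₙ` for every `n`; in particular each `Cₙ` is nonempty (so the sequence is well defined). -/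
theorem statement12 (H : Type*) [NormedAddCommGroup H] [InnerProductSpace ℝ H] [CompleteSpace H]
    (C : Set H) (hCne : C.Nonempty) (hCclosed : IsClosed C) (hCconv : Convex ℝ C)
    (L N : ℕ) (hL : 0 < L) (hN : 0 < N)
    (f : Fin L → H → H → ℝ)
    (hA1 : ∀ l, ∀ x ∈ C, f l x x = 0)
    (hA2 : ∀ l, ∀ x ∈ C, ∀ y ∈ C, f l x y + f l y x ≤ 0)
    (hA3 : ∀ l, ∀ x ∈ C, ∀ y ∈ C, ∀ z ∈ C,
      Filter.limsup (fun t : ℝ => f l (t • z + (1 - t) • x) y) (nhdsWithin 0 (Set.Ioi 0))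
        ≤ f l x y)
    (hA4 : ∀ l, ∀ x ∈ C, ConvexOn ℝ C (f l x) ∧ LowerSemicontinuousOn (f l x) C)
    (A : Fin N → H → H)
    (hAcont : ∀ k, ContinuousOn (A k) C)
    (hAmono : ∀ k, ∀ u ∈ C, ∀ v ∈ C, 0 ≤ ⟪u - v, A k u - A k v⟫)
    (T : ℕ → H → H)
    (B : Set H)
    (hB : B = (⋂ n, {p ∈ C | T n p = p}) ∩
        (⋂ l, {p ∈ C | ∀ y ∈ C, 0 ≤ f l p y}) ∩
        (⋂ k, {p ∈ C | ∀ y ∈ C, 0 ≤ ⟪y - p, A k p⟫}))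
    (hBne : B.Nonempty)
    (hTquasi : ∀ n, ∀ w ∈ C, ∀ p ∈ B, ‖T n w - p‖ ≤ ‖w - p‖)
    (α₁ α₂ α₃ : ℝ)
    (hα₁ : α₁ ∈ Set.Ioo (0 : ℝ) 1) (hα₂ : α₂ ∈ Set.Ioo (0 : ℝ) 1)
    (hα₃ : α₃ ∈ Set.Ioo (0 : ℝ) 1) (hαsum : α₁ + α₂ + α₃ = 1)
    (a : ℝ) (ha : 0 < a) (rn : ℕ → ℝ) (hrn : ∀ n, a ≤ rn n)
    (x : H) (hx : x ∈ C)
    (xseq zseq useq yseq : ℕ → H) (Cset : ℕ → Set H)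
    (hx0 : xseq 0 = x) (hC0 : Cset 0 = C)
    (hzseq : ∀ n, zseq n ∈ C ∧ ∀ y ∈ C,
      0 ≤ f ⟨n % L, Nat.mod_lt n hL⟩ (zseq n) y +
        (1 / rn n) * ⟪y - zseq n, zseq n - xseq n⟫)
    (huseq : ∀ n, useq n ∈ C ∧ ∀ y ∈ C,
      0 ≤ ⟪y - useq n, A ⟨n % N, Nat.mod_lt n hN⟩ (useq n)⟫ +
        (1 / rn n) * ⟪y - useq n, useq n - xseq n⟫)
    (hyseq : ∀ n, yseq n = α₁ • xseq n + α₂ • zseq n + α₃ • T n (useq n))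
    (hCrec : ∀ n, Cset (n + 1) = {z ∈ Cset n | ‖z - yseq n‖ ≤ ‖z - xseq n‖})
    (hxnext : ∀ n, xseq (n + 1) ∈ Cset (n + 1) ∧
      ∀ w ∈ Cset (n + 1), ‖x - xseq (n + 1)‖ ≤ ‖x - w‖) :
    ∀ n, B ⊆ Cset n ∧ (Cset n).Nonempty := by
  have hsub : ∀ n, B ⊆ Cset n := by
    intro n
    induction n with
    | zero =>
      intro p hp
      rw [hB] at hp
      rw [hC0]
      exact (Set.mem_iInter.mp hp.1.1 0).1
    | succ n ih =>
      intro p hp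
      have hp' := hp
      rw [hB] at hp'
      obtain ⟨⟨hpT, hpf⟩, hpA⟩ := hp'
      have hpC : p ∈ C := (Set.mem_iInter.mp hpT n).1
      have hr : 0 < rn n := ha.trans_le (hrn n)
      obtain ⟨hzC, hz⟩ := hzseq n
      obtain ⟨huC, hu⟩ := huseq n
      have hzp : ‖zseq n - p‖ ≤ ‖xseq n - p‖ := by
        refine norm_sub_le_of_resolvent_ineq hr ?_ (hz p hpC)
        have hnonneg := (Set.mem_iInter.mp hpf ⟨n % L, Nat.mod_lt n hL⟩).2 _ hzC
        have hmono := hA2 ⟨n % L, Nat.mod_lt n hL⟩ _ hzC p hpC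
        linarith
      have hup : ‖useq n - p‖ ≤ ‖xseq n - p‖ := by
        refine norm_sub_le_of_resolvent_ineq hr ?_ (hu p hpC)
        have hnonneg := (Set.mem_iInter.mp hpA ⟨n % N, Nat.mod_lt n hN⟩).2 _ huC
        have hmono := hAmono ⟨n % N, Nat.mod_lt n hN⟩ _ huC p hpC
        rw [inner_sub_right] at hmono
        rw [← neg_sub, inner_neg_left]
        linarith
      rw [hCrec]
      refine ⟨ih hp, ?_⟩
      rw [norm_sub_rev p, norm_sub_rev p, hyseq]
      exact norm_convex_combination_sub_le hα₁.1.le hα₂.1.le hα₃.1.le hαsum le_rfl hzp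
        ((hTquasi n _ huC p hp).trans hup)
  exact fun n => ⟨hsub n, hBne.mono (hsub n)⟩
end

section
/- Let H be a real Hilbert space, C a nonempty closed convex subset of H, and f : C × C → ℝ a bifunction satisfying conditions (A1)–(A4). Let (z_n) be a sequence in C converging strongly to x* ∈ C and (w_n) a sequence in H converging strongly to 0 such that for every n and every y ∈ C, f(z_n, y) + ⟨y − z_n, w_n⟩ ≥ 0. Then f(x*, y) ≥ 0 for all y ∈ C, i.e. x* ∈ EP(f). -/
open scoped RealInnerProductSpace

/-- Step 5 abstracted: if `f` satisfies (A1)–(A4) on `C`, `zₙ → x*` in `C`,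
`wₙ → 0`, and `f(zₙ, y) + ⟨y - zₙ, wₙ⟩ ≥ 0` for every `y ∈ C` and every `n`, then
`x* ∈ EP(f)`. -/
theorem statement15 (H : Type*) [NormedAddCommGroup H] [InnerProductSpace ℝ H] [CompleteSpace H]
    (C : Set H) (hCne : C.Nonempty) (hCclosed : IsClosed C) (hCconv : Convex ℝ C)
    (f : H → H → ℝ)
    (hA1 : ∀ x ∈ C, f x x = 0)
    (hA2 : ∀ x ∈ C, ∀ y ∈ C, f x y + f y x ≤ 0)
    (hA3 : ∀ x ∈ C, ∀ y ∈ C, ∀ z ∈ C,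
      Filter.limsup (fun t : ℝ => f (t • z + (1 - t) • x) y) (nhdsWithin 0 (Set.Ioi 0)) ≤ f x y)
    (hA4 : ∀ x ∈ C, ConvexOn ℝ C (f x) ∧ LowerSemicontinuousOn (f x) C)
    (z : ℕ → H) (hz : ∀ n, z n ∈ C)
    (xstar : H) (hxstar : xstar ∈ C)
    (hzlim : Filter.Tendsto z Filter.atTop (nhds xstar))
    (w : ℕ → H) (hwlim : Filter.Tendsto w Filter.atTop (nhds 0))
    (hineq : ∀ n, ∀ y ∈ C, 0 ≤ f (z n) y + ⟪y - z n, w n⟫) :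
    ∀ y ∈ C, 0 ≤ f xstar y := by
  have minty : ∀ y ∈ C, f y xstar ≤ 0 := by
    intro y hy
    have hlim : Filter.Tendsto (fun n => ⟪y - z n, w n⟫) Filter.atTop (nhds 0) := by
      simpa using (tendsto_const_nhds.sub hzlim).inner (𝕜 := ℝ) hwlim
    have hzC : Filter.Tendsto z Filter.atTop (nhdsWithin xstar C) :=
      tendsto_nhdsWithin_iff.2 ⟨hzlim, Filter.Eventually.of_forall hz⟩
    refine le_of_forall_lt fun c hc => ?_
    obtain ⟨d, hcd, hd⟩ := exists_between hc
    refine hcd.trans_le (ge_of_tendsto hlim ?_)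
    filter_upwards [hzC.eventually ((hA4 y hy).2 xstar hxstar d hd)] with n hn
    linarith [hA2 y hy (z n) (hz n), hineq n y hy]
  intro y hy
  refine le_trans (Real.sInf_nonneg fun a ha => ?_) (hA3 xstar hxstar y hy y hy)
  rw [Set.mem_ofPred_eq, Filter.eventually_map] at ha
  have hmem : Set.Ioo (0 : ℝ) 1 ∈ nhdsWithin 0 (Set.Ioi 0) := Ioo_mem_nhdsGT one_pos
  obtain ⟨t, hta, ht0, ht1⟩ := (ha.and hmem).exists
  refine le_trans ?_ hta
  have hsub : 0 ≤ 1 - t := sub_nonneg.2 ht1.le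
  have hu : t • y + (1 - t) • xstar ∈ C := hCconv hy hxstar ht0.le hsub (by ring)
  have hconv := (hA4 _ hu).1.2 hy hxstar ht0.le hsub (by ring)
  rw [hA1 _ hu, smul_eq_mul, smul_eq_mul] at hconv
  have hx := mul_nonpos_of_nonneg_of_nonpos hsub (minty _ hu)
  exact nonneg_of_mul_nonneg_right (by linarith) ht0
end

section
/- Let H be a real Hilbert space and C a nonempty closed convex subset of H. Let f_1,…,f_L : C × C → ℝ be bifunctions satisfying conditions (A1)–(A4), let A_1,…,A_N : C → H be continuous monotone maps, let (T_n)_{n≥1} be a sequence of nonexpansive maps from C to H, and let Γ be a family of closed generalized nonexpansive maps from C to H such that ⋂_{n≥1} F(T_n) = F(Γ) ≠ ∅, where F(Γ) is the set of common fixed points of Γ, and such that (T_n) satisfies the NST-condition with Γ. Assume B := F(Γ) ∩ (⋂_{l=1}^{L} EP(f_l)) ∩ (⋂_{k=1}^{N} VI(C,A_k)) ≠ ∅. Fix α₁, α₂, α₃ ∈ (0,1) with α₁+α₂+α₃ = 1, a > 0 and real numbers r_n ≥ a. Define the sequence (x_n) by: x₁ = x ∈ C, C₁ = C, and for n ≥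 1: z_n is the point of C satisfying f_{n mod L}(z_n, y) + (1/r_n)⟨y − z_n, z_n − x_n⟩ ≥ 0 for all y ∈ C; u_n is the point of C satisfying ⟨y − u_n, A_{n mod N} u_n⟩ + (1/r_n)⟨y − u_n, u_n − x_n⟩ ≥ 0 for all y ∈ C; y_n = α₁x_n + α₂z_n + α₃T_n u_n; C_{n+1} = {z ∈ C_n : ‖z − y_n‖ ≤ ‖z − x_n‖}; and x_{n+1} = P_{C_{n+1}} x. Then B is a nonempty closed convex set and (x_n) converges strongly to P_B x. -/
open scoped RealInnerProductSpace
open Filter Topology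

section Normed

variable {H : Type*} [NormedAddCommGroup H] {C : Set H}

theorem LowerSemicontinuousOn.nonpos_of_tendsto {g : H → ℝ} (hg : LowerSemicontinuousOn g C)
    {z : ℕ → H} {p : H} (hz : ∀ n, z n ∈ C) (hp : p ∈ C) (hzp : Tendsto z atTop (𝓝 p))
    {e : ℕ → ℝ} (he : Tendsto e atTop (𝓝 0)) (hle : ∀ n, g (z n) ≤ e n) : g p ≤ 0 := by
  by_contra! h
  have h1 := hg p hp (g p / 2) (by linarith)
  have h2 : Tendsto z atTop (𝓝[C] p) :=
    tendsto_nhdsWithin_iff.2 ⟨hzp, Eventually.of_forall hz⟩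
  obtain ⟨n, hn, hn'⟩ :=
    ((h2.eventually h1).and (he.eventually_lt_const (by linarith : 0 < g p / 2))).exists
  linarith [hle n]

theorem isClosed_fixedPoints_of_nonexpansive (hC : IsClosed C) {T : H → H}
    (hT : ∀ u ∈ C, ∀ v ∈ C, ‖T u - T v‖ ≤ ‖u - v‖) : IsClosed {p ∈ C | T p = p} := by
  have hcont : ContinuousOn T C :=
    (LipschitzOnWith.of_dist_le_mul (K := 1) fun u hu v hv => by
      simpa [dist_eq_norm] using hT u hu v hv).continuousOn
  refine IsSeqClosed.isClosed fun z p hz hzp => ?_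
  have hp : p ∈ C := hC.mem_of_tendsto hzp (Eventually.of_forall fun n => (hz n).1)
  have h2 : Tendsto z atTop (𝓝[C] p) :=
    tendsto_nhdsWithin_iff.2 ⟨hzp, Eventually.of_forall fun n => (hz n).1⟩
  have h3 := (hcont p hp).tendsto.comp h2
  exact ⟨hp, tendsto_nhds_unique (h3.congr fun n => (hz n).2) hzp⟩

theorem tendsto_zero_of_mul_norm_sq_le {v : ℕ → H} {c : ℝ} (hc : 0 < c) {e : ℕ → ℝ}
    (he : Tendsto e atTop (𝓝 0)) (h : ∀ n, c * ‖v n‖ ^ 2 ≤ e n) : Tendsto v atTop (𝓝 0) := by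
  have h1 : Tendsto (fun n => ‖v n‖ ^ 2) atTop (𝓝 0) := by
    refine squeeze_zero (fun n => sq_nonneg _) (fun n => ?_)
      (by simpa using he.const_mul c⁻¹ : Tendsto (fun n => c⁻¹ * e n) atTop (𝓝 0))
    rw [inv_mul_eq_div, le_div_iff₀ hc]
    linarith [h n]
  refine tendsto_zero_iff_norm_tendsto_zero.2 ?_
  simpa using h1.sqrt

theorem tendsto_add_mul_atTop (l : ℕ) {L : ℕ} (hL : 0 < L) :
    Tendsto (fun k => l + k * L) atTop atTop :=
  tendsto_atTop_mono (fun k => (Nat.le_mul_of_pos_right k hL).trans (Nat.le_add_left _ _))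
    tendsto_id

end Normed

section InnerProduct

variable {H : Type*} [NormedAddCommGroup H] [InnerProductSpace ℝ H] {C : Set H}

/-- Monotone bifunctions on `C` satisfying the usual conditions (A1)–(A4) of equilibrium
problems. -/
structure IsEquilibriumBifunction (C : Set H) (f : H → H → ℝ) : Prop where
  diag : ∀ x ∈ C, f x x = 0
  monotone : ∀ x ∈ C, ∀ y ∈ C, f x y + f y x ≤ 0
  limsup_le : ∀ x ∈ C, ∀ y ∈ C, ∀ z ∈ C,
    limsup (fun t : ℝ => f (t • z + (1 - t) • x) y) (𝓝[>] 0) ≤ f x y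
  convexOn : ∀ x ∈ C, ConvexOn ℝ C (f x)
  lowerSemicontinuousOn : ∀ x ∈ C, LowerSemicontinuousOn (f x) C

/-- The solution set of the equilibrium problem for `f` on `C`. -/
def equilibriumSet (C : Set H) (f : H → H → ℝ) : Set H := {p ∈ C | ∀ y ∈ C, 0 ≤ f p y}

/-- `z` is the value at `x` of the resolvent of `f` with parameter `r`. -/
def IsResolventPoint (C : Set H) (f : H → H → ℝ) (r : ℝ) (x z : H) : Prop :=
  z ∈ C ∧ ∀ y ∈ C, 0 ≤ f z y + (1 / r) * ⟪y - z, z - x⟫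

namespace IsEquilibriumBifunction

variable {f : H → H → ℝ}

/-- Minty's lemma for equilibrium problems. -/
theorem mem_equilibriumSet_iff (hf : IsEquilibriumBifunction C f) (hC : Convex ℝ C) {p : H} :
    p ∈ equilibriumSet C f ↔ p ∈ C ∧ ∀ y ∈ C, f y p ≤ 0 := by
  refine ⟨fun h => ⟨h.1, fun y hy => ?_⟩, fun h => ⟨h.1, fun y hy => ?_⟩⟩
  · linarith [h.2 y hy, hf.monotone p h.1 y hy]
  refine le_trans ?_ (hf.limsup_le p h.1 y hy y hy)
  have key : ∀ᶠ t : ℝ in 𝓝[>] 0, 0 ≤ f (t • y + (1 - t) • p) y := by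
    filter_upwards [Ioo_mem_nhdsGT (zero_lt_one' ℝ)] with t ht
    have hw : t • y + (1 - t) • p ∈ C := hC hy h.1 ht.1.le (by linarith [ht.2]) (by ring)
    have h1 := (hf.convexOn _ hw).2 hy h.1 ht.1.le (by linarith [ht.2] : 0 ≤ 1 - t) (by ring)
    rw [hf.diag _ hw, smul_eq_mul, smul_eq_mul] at h1
    have h2 := mul_nonpos_of_nonneg_of_nonpos (by linarith [ht.2] : 0 ≤ 1 - t) (h.2 _ hw)
    exact nonneg_of_mul_nonneg_right (by linarith) ht.1
  rw [limsup_eq]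
  refine Real.sInf_nonneg fun b hb => ?_
  obtain ⟨t, ht, ht'⟩ := (key.and hb).exists
  exact ht.trans ht'

theorem isClosed_equilibriumSet (hf : IsEquilibriumBifunction C f) (hC : Convex ℝ C)
    (hCc : IsClosed C) : IsClosed (equilibriumSet C f) := by
  refine IsSeqClosed.isClosed fun z p hz hzp => ?_
  have hz' := fun n => (hf.mem_equilibriumSet_iff hC).1 (hz n)
  have hp : p ∈ C := hCc.mem_of_tendsto hzp (Eventually.of_forall fun n => (hz n).1)
  exact (hf.mem_equilibriumSet_iff hC).2 ⟨hp, fun y hy =>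
    (hf.lowerSemicontinuousOn y hy).nonpos_of_tendsto (fun n => (hz n).1) hp hzp
      tendsto_const_nhds fun n => (hz' n).2 y hy⟩

theorem convex_equilibriumSet (hf : IsEquilibriumBifunction C f) (hC : Convex ℝ C) :
    Convex ℝ (equilibriumSet C f) := by
  intro p hp q hq s t hs ht hst
  rw [hf.mem_equilibriumSet_iff hC] at hp hq ⊢
  refine ⟨hC hp.1 hq.1 hs ht hst, fun y hy => ?_⟩
  have h := (hf.convexOn y hy).2 hp.1 hq.1 hs ht hst
  simp only [smul_eq_mul] at h
  linarith [mul_nonpos_of_nonneg_of_nonpos hs (hp.2 y hy),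
    mul_nonpos_of_nonneg_of_nonpos ht (hq.2 y hy)]

theorem norm_sq_add_norm_sq_le (hf : IsEquilibriumBifunction C f) {r : ℝ} (hr : 0 < r)
    {x z p : H} (hz : IsResolventPoint C f r x z) (hp : p ∈ equilibriumSet C f) :
    ‖z - p‖ ^ 2 + ‖x - z‖ ^ 2 ≤ ‖x - p‖ ^ 2 := by
  have h1 := hz.2 p hp.1
  have h2 := hf.monotone z hz.1 p hp.1
  have h3 := hp.2 z hz.1
  have h4 : 0 ≤ ⟪p - z, z - x⟫ :=
    nonneg_of_mul_nonneg_right (by linarith) (one_div_pos.2 hr)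
  have h5 : x - p = (x - z) + (z - p) := by abel
  have h6 : ⟪x - z, z - p⟫ = ⟪p - z, z - x⟫ := by
    rw [← neg_sub z x, ← neg_sub z p, inner_neg_left, inner_neg_left, real_inner_comm]
  rw [h5, norm_add_sq_real, h6]
  linarith

theorem mem_equilibriumSet_of_tendsto (hf : IsEquilibriumBifunction C f) (hC : Convex ℝ C)
    {a : ℝ} (ha : 0 < a) {r : ℕ → ℝ} (hr : ∀ n, a ≤ r n) {x z : ℕ → H} {p : H}
    (hz : ∀ n, IsResolventPoint C f (r n) (x n) (z n)) (hp : p ∈ C)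
    (hxp : Tendsto x atTop (𝓝 p)) (hzp : Tendsto z atTop (𝓝 p)) :
    p ∈ equilibriumSet C f := by
  refine (hf.mem_equilibriumSet_iff hC).2 ⟨hp, fun y hy => ?_⟩
  have he : Tendsto (fun n => (1 / a) * (‖y - z n‖ * ‖z n - x n‖)) atTop (𝓝 0) := by
    have := ((tendsto_const_nhds.sub hzp : Tendsto (fun n => y - z n) _ _).norm.mul
      (hzp.sub hxp).norm).const_mul (1 / a)
    simpa using this
  refine (hf.lowerSemicontinuousOn y hy).nonpos_of_tendsto (fun n => (hz n).1) hp hzp he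
    fun n => ?_
  have h1 := (hz n).2 y hy
  have h2 := hf.monotone y hy (z n) (hz n).1
  have hr0 : 0 < r n := ha.trans_le (hr n)
  have h3 : (1 / r n) * ⟪y - z n, z n - x n⟫ ≤ (1 / a) * (‖y - z n‖ * ‖z n - x n‖) :=
    (mul_le_mul_of_nonneg_left (real_inner_le_norm _ _) (by positivity)).trans
      (mul_le_mul_of_nonneg_right (one_div_le_one_div_of_le ha (hr n)) (by positivity))
  linarith

/-- A variational inequality for a continuous monotone map is an equilibrium problem. -/
theorem of_continuousOn_monotone (hC : Convex ℝ C) {A : H → H} (hA : ContinuousOn A C)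
    (hmono : ∀ u ∈ C, ∀ v ∈ C, 0 ≤ ⟪u - v, A u - A v⟫) :
    IsEquilibriumBifunction C (fun u v => ⟪v - u, A u⟫) where
  diag u _ := by simp
  monotone u hu v hv := by
    have h := hmono u hu v hv
    rw [inner_sub_right] at h
    rw [← neg_sub u v, inner_neg_left]
    linarith
  limsup_le u hu v _ w hw := by
    refine (Tendsto.limsup_eq ?_).le
    have h1 : Tendsto (fun t : ℝ => t • w + (1 - t) • u) (𝓝[>] 0) (𝓝 u) := by
      have : Continuous fun t : ℝ => t • w + (1 - t) • u := by fun_prop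
      simpa using (this.tendsto 0).mono_left (nhdsWithin_le_nhds (s := Set.Ioi 0))
    have h2 : Tendsto (fun t : ℝ => t • w + (1 - t) • u) (𝓝[>] 0) (𝓝[C] u) := by
      refine tendsto_nhdsWithin_iff.2 ⟨h1, ?_⟩
      filter_upwards [Ioo_mem_nhdsGT (zero_lt_one' ℝ)] with t ht
      exact hC hw hu ht.1.le (by linarith [ht.2]) (by ring)
    exact (tendsto_const_nhds.sub h1).inner ((hA u hu).tendsto.comp h2)
  convexOn u _ := by
    refine ⟨hC, fun v _ w _ s t _ _ hst => le_of_eq ?_⟩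
    have : s • v + t • w - u = s • (v - u) + t • (w - u) := by
      rw [smul_sub, smul_sub, sub_add_sub_comm, ← add_smul, hst, one_smul]
    simp only [this, inner_add_left, real_inner_smul_left, smul_eq_mul]
  lowerSemicontinuousOn u _ :=
    Continuous.lowerSemicontinuous (by fun_prop) |>.lowerSemicontinuousOn _

end IsEquilibriumBifunction

theorem mul_norm_sub_sq_add_mul_norm_sub_sq (v p q : H) {s t : ℝ} (hst : s + t = 1) :
    s * ‖v - p‖ ^ 2 + t * ‖v - q‖ ^ 2
      = ‖v - (s • p + t • q)‖ ^ 2 + s * t * ‖p - q‖ ^ 2 := by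
  obtain rfl : s = 1 - t := by linarith
  have h : v - ((1 - t) • p + t • q) = (v - p) + t • (p - q) := by module
  have h' : v - q = (v - p) + (p - q) := by abel
  rw [h, h', norm_add_sq_real, norm_add_sq_real, real_inner_smul_right, norm_smul, mul_pow,
    Real.norm_eq_abs, sq_abs]
  ring

theorem convex_fixedPoints_of_nonexpansive (hC : Convex ℝ C) {T : H → H}
    (hT : ∀ u ∈ C, ∀ v ∈ C, ‖T u - T v‖ ≤ ‖u - v‖) : Convex ℝ {p ∈ C | T p = p} := by
  intro p hp q hq s t hs ht hst
  have hw := hC hp.1 hq.1 hs ht hst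
  refine ⟨hw, ?_⟩
  have h1 := mul_norm_sub_sq_add_mul_norm_sub_sq (T (s • p + t • q)) p q hst
  have h2 := mul_norm_sub_sq_add_mul_norm_sub_sq (s • p + t • q) p q hst
  have h3 := hT _ hw p hp.1
  have h4 := hT _ hw q hq.1
  rw [hp.2] at h3
  rw [hq.2] at h4
  have h5 := mul_le_mul_of_nonneg_left (pow_le_pow_left₀ (norm_nonneg _) h3 2) hs
  have h6 := mul_le_mul_of_nonneg_left (pow_le_pow_left₀ (norm_nonneg _) h4 2) ht
  rw [sub_self, norm_zero] at h2
  refine sub_eq_zero.1 (norm_eq_zero.1 (pow_eq_zero_iff two_ne_zero |>.1 ?_))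
  exact le_antisymm (by linarith) (sq_nonneg _)

theorem convex_setOf_norm_sub_le_norm_sub (x y : H) :
    Convex ℝ {z : H | ‖z - y‖ ≤ ‖z - x‖} := by
  intro p hp q hq s t hs ht hst
  have h1 := mul_norm_sub_sq_add_mul_norm_sub_sq y p q hst
  have h2 := mul_norm_sub_sq_add_mul_norm_sub_sq x p q hst
  have h3 := mul_le_mul_of_nonneg_left (pow_le_pow_left₀ (norm_nonneg _) hp 2) hs
  have h4 := mul_le_mul_of_nonneg_left (pow_le_pow_left₀ (norm_nonneg _) hq 2) ht
  simp only [norm_sub_rev p, norm_sub_rev q y, norm_sub_rev q x] at h3 h4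
  refine le_of_sq_le_sq ?_ (norm_nonneg _)
  rw [norm_sub_rev _ y, norm_sub_rev _ x]
  rw [norm_sub_rev y p, norm_sub_rev x p] at *
  linarith

theorem norm_sub_sq_le_of_forall_norm_sub_le {K : Set H} (hK : Convex ℝ K) {x p w : H}
    (hp : p ∈ K) (hmin : ∀ v ∈ K, ‖x - p‖ ≤ ‖x - v‖) (hw : w ∈ K) :
    ‖w - p‖ ^ 2 ≤ ‖x - w‖ ^ 2 - ‖x - p‖ ^ 2 := by
  have hinf : ‖x - p‖ = ⨅ v : K, ‖x - v‖ := by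
    have : Nonempty K := ⟨⟨p, hp⟩⟩
    exact le_antisymm (le_ciInf fun v => hmin v v.2)
      (ciInf_le ⟨0, by rintro _ ⟨v, rfl⟩; exact norm_nonneg _⟩ (⟨p, hp⟩ : K))
  have h := (norm_eq_iInf_iff_real_inner_le_zero hK hp).1 hinf w hw
  have h' : x - w = (x - p) - (w - p) := by abel
  rw [h', norm_sub_sq_real (x - p)]
  linarith

theorem norm_smul_add_smul_add_smul_sq_le (u v w : H) {α β γ : ℝ} (hα : 0 ≤ α) (hβ : 0 ≤ β)
    (hγ : 0 ≤ γ) (h : α + β + γ = 1) :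
    ‖α • u + β • v + γ • w‖ ^ 2 ≤ α * ‖u‖ ^ 2 + β * ‖v‖ ^ 2 + γ * ‖w‖ ^ 2 := by
  have hn : ‖α • u + β • v + γ • w‖ ≤ α * ‖u‖ + β * ‖v‖ + γ * ‖w‖ := by
    refine norm_add₃_le.trans_eq ?_
    simp [norm_smul, abs_of_nonneg, hα, hβ, hγ]
  refine (pow_le_pow_left₀ (norm_nonneg _) hn 2).trans ?_
  obtain rfl : α = 1 - β - γ := by linarith
  nlinarith [mul_nonneg (mul_nonneg hα hβ) (sq_nonneg (‖u‖ - ‖v‖)),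
    mul_nonneg (mul_nonneg hα hγ) (sq_nonneg (‖u‖ - ‖w‖)),
    mul_nonneg (mul_nonneg hβ hγ) (sq_nonneg (‖v‖ - ‖w‖))]

/-- Metric projections of a point onto a decreasing sequence of convex sets converge, provided
that they stay bounded. -/
theorem cauchySeq_of_antitone_of_forall_norm_sub_le {K : ℕ → Set H} (hanti : Antitone K)
    (hconv : ∀ n, Convex ℝ (K n)) {x b : H} (hb : ∀ n, b ∈ K n) {u : ℕ → H}
    (hu : ∀ n, u n ∈ K n) (hmin : ∀ n, ∀ w ∈ K n, ‖x - u n‖ ≤ ‖x - w‖) : CauchySeq u := by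
  have hmono : Monotone fun n => ‖x - u n‖ ^ 2 := fun m n hmn =>
    pow_le_pow_left₀ (norm_nonneg _) (hmin m _ (hanti hmn (hu n))) 2
  have hbdd : BddAbove (Set.range fun n => ‖x - u n‖ ^ 2) := by
    refine ⟨‖x - b‖ ^ 2, ?_⟩
    rintro _ ⟨n, rfl⟩
    exact pow_le_pow_left₀ (norm_nonneg _) (hmin n b (hb n)) 2
  have hc := (tendsto_atTop_ciSup hmono hbdd).cauchySeq
  rw [Metric.cauchySeq_iff'] at hc ⊢
  intro ε hε
  obtain ⟨m, hm⟩ := hc (ε ^ 2) (by positivity)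
  refine ⟨m, fun n hn => ?_⟩
  have h1 := norm_sub_sq_le_of_forall_norm_sub_le (hconv m) (hu m) (hmin m) (hanti hn (hu n))
  have h2 := (le_abs_self _).trans_lt (Real.dist_eq _ _ ▸ hm n hn)
  rw [dist_eq_norm]
  exact lt_of_pow_lt_pow_left₀ 2 hε.le (h1.trans_lt h2)

end InnerProduct

/-- Hilbert-space case of the main theorem, Corollary 4.3 of the paper; indices
relabelled to start at `0`: for bifunctions `f₁, …, f_L` satisfying (A1)–(A4), continuous
monotone maps `A₁, …, A_N`, a sequence `(Tₙ)` of nonexpansive maps and a family `Γ` of closed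
generalized nonexpansive maps with `⋂ₙ F(Tₙ) = F(Γ) ≠ ∅` and `(Tₙ)` satisfying the NST-condition
with `Γ`, if `B := F(Γ) ∩ (⋂ₗ EP(fₗ)) ∩ (⋂ₖ VI(C,Aₖ)) ≠ ∅` then `B` is closed and convex and the
hybrid sequence `(xₙ)` converges strongly to `P_B x`. -/
theorem statement17 (H : Type*) [NormedAddCommGroup H] [InnerProductSpace ℝ H] [CompleteSpace H]
    (C : Set H) (hCne : C.Nonempty) (hCclosed : IsClosed C) (hCconv : Convex ℝ C)
    (L N : ℕ) (hL : 0 < L) (hN : 0 < N)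
    (f : Fin L → H → H → ℝ)
    (hA1 : ∀ l, ∀ x ∈ C, f l x x = 0)
    (hA2 : ∀ l, ∀ x ∈ C, ∀ y ∈ C, f l x y + f l y x ≤ 0)
    (hA3 : ∀ l, ∀ x ∈ C, ∀ y ∈ C, ∀ z ∈ C,
      Filter.limsup (fun t : ℝ => f l (t • z + (1 - t) • x) y) (nhdsWithin 0 (Set.Ioi 0))
        ≤ f l x y)
    (hA4 : ∀ l, ∀ x ∈ C, ConvexOn ℝ C (f l x) ∧ LowerSemicontinuousOn (f l x) C)
    (A : Fin N → H → H)
    (hAcont : ∀ k, ContinuousOn (A k) C)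
    (hAmono : ∀ k, ∀ u ∈ C, ∀ v ∈ C, 0 ≤ ⟪u - v, A k u - A k v⟫)
    (T : ℕ → H → H)
    (hTnonexp : ∀ n, ∀ u ∈ C, ∀ v ∈ C, ‖T n u - T n v‖ ≤ ‖u - v‖)
    (Γ : Set (H → H))
    -- each member of Γ is generalized nonexpansive:
    (hΓgen : ∀ S ∈ Γ, {p ∈ C | S p = p}.Nonempty ∧
      ∀ w ∈ C, ∀ p ∈ {p ∈ C | S p = p}, ‖S w - p‖ ≤ ‖w - p‖)
    -- each member of Γ is a closed map:
    (hΓclosed : ∀ S ∈ Γ, ∀ u : ℕ → H, (∀ n, u n ∈ C) → ∀ p ∈ C,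
      Filter.Tendsto u Filter.atTop (nhds p) →
      ∀ q : H, Filter.Tendsto (fun n => S (u n)) Filter.atTop (nhds q) → S p = q)
    (FΓ : Set H) (hFΓ : FΓ = {p ∈ C | ∀ S ∈ Γ, S p = p})
    (hcommon : (⋂ n, {p ∈ C | T n p = p}) = FΓ) (hFΓne : FΓ.Nonempty)
    -- NST-condition of (Tₙ) with Γ:
    (hNST : ∀ u : ℕ → H, (∀ n, u n ∈ C) → Bornology.IsBounded (Set.range u) →
      Filter.Tendsto (fun n => ‖u n - T n (u n)‖) Filter.atTop (nhds 0) →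
      ∀ S ∈ Γ, Filter.Tendsto (fun n => ‖u n - S (u n)‖) Filter.atTop (nhds 0))
    (B : Set H)
    (hB : B = FΓ ∩ (⋂ l, {p ∈ C | ∀ y ∈ C, 0 ≤ f l p y}) ∩
        (⋂ k, {p ∈ C | ∀ y ∈ C, 0 ≤ ⟪y - p, A k p⟫}))
    (hBne : B.Nonempty)
    (α₁ α₂ α₃ : ℝ)
    (hα₁ : α₁ ∈ Set.Ioo (0 : ℝ) 1) (hα₂ : α₂ ∈ Set.Ioo (0 : ℝ) 1)
    (hα₃ : α₃ ∈ Set.Ioo (0 : ℝ) 1) (hαsum : α₁ + α₂ + α₃ = 1)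
    (a : ℝ) (ha : 0 < a) (rn : ℕ → ℝ) (hrn : ∀ n, a ≤ rn n)
    (x : H) (hx : x ∈ C)
    (xseq zseq useq yseq : ℕ → H) (Cset : ℕ → Set H)
    (hx0 : xseq 0 = x) (hC0 : Cset 0 = C)
    (hzseq : ∀ n, zseq n ∈ C ∧ ∀ y ∈ C,
      0 ≤ f ⟨n % L, Nat.mod_lt n hL⟩ (zseq n) y +
        (1 / rn n) * ⟪y - zseq n, zseq n - xseq n⟫)
    (huseq : ∀ n, useq n ∈ C ∧ ∀ y ∈ C,
      0 ≤ ⟪y - useq n, A ⟨n % N, Nat.mod_lt n hN⟩ (useq n)⟫ +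
        (1 / rn n) * ⟪y - useq n, useq n - xseq n⟫)
    (hyseq : ∀ n, yseq n = α₁ • xseq n + α₂ • zseq n + α₃ • T n (useq n))
    (hCrec : ∀ n, Cset (n + 1) = {z ∈ Cset n | ‖z - yseq n‖ ≤ ‖z - xseq n‖})
    -- xₙ₊₁ = P_{Cₙ₊₁} x :
    (hxnext : ∀ n, xseq (n + 1) ∈ Cset (n + 1) ∧
      ∀ w ∈ Cset (n + 1), ‖x - xseq (n + 1)‖ ≤ ‖x - w‖) :
    (IsClosed B ∧ Convex ℝ B) ∧
      ∃ p : H, p ∈ B ∧ (∀ w ∈ B, ‖x - p‖ ≤ ‖x - w‖) ∧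
        Filter.Tendsto xseq Filter.atTop (nhds p) := by
  have hf : ∀ l, IsEquilibriumBifunction C (f l) := fun l =>
    ⟨hA1 l, hA2 l, hA3 l, fun u hu => (hA4 l u hu).1, fun u hu => (hA4 l u hu).2⟩
  have hg : ∀ k, IsEquilibriumBifunction C (fun u v => ⟪v - u, A k u⟫) := fun k =>
    .of_continuousOn_monotone hCconv (hAcont k) (hAmono k)
  have hB' : B = (⋂ n, {p ∈ C | T n p = p}) ∩ (⋂ l, equilibriumSet C (f l)) ∩
      ⋂ k, equilibriumSet C (fun u v => ⟪v - u, A k u⟫) := by rw [hB, ← hcommon]; rfl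
  have hBmem : ∀ p, p ∈ B ↔ (p ∈ FΓ ∧ ∀ l, p ∈ equilibriumSet C (f l)) ∧
      ∀ k, p ∈ equilibriumSet C (fun u v => ⟪v - u, A k u⟫) := fun p => by
    rw [hB', hcommon]; simp only [Set.mem_inter_iff, Set.mem_iInter]
  have hrpos : ∀ n, 0 < rn n := fun n => ha.trans_le (hrn n)
  have hzres : ∀ n, IsResolventPoint C (f ⟨n % L, Nat.mod_lt n hL⟩) (rn n) (xseq n) (zseq n) :=
    hzseq
  have hures : ∀ n, IsResolventPoint C (fun u v => ⟪v - u, A ⟨n % N, Nat.mod_lt n hN⟩ u⟫)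
      (rn n) (xseq n) (useq n) := huseq
  refine ⟨⟨?_, ?_⟩, ?_⟩
  · rw [hB']
    exact ((isClosed_iInter fun n => isClosed_fixedPoints_of_nonexpansive hCclosed
      (hTnonexp n)).inter (isClosed_iInter fun l =>
        (hf l).isClosed_equilibriumSet hCconv hCclosed)).inter
          (isClosed_iInter fun k => (hg k).isClosed_equilibriumSet hCconv hCclosed)
  · rw [hB']
    exact ((convex_iInter fun n => convex_fixedPoints_of_nonexpansive hCconv
      (hTnonexp n)).inter (convex_iInter fun l =>
        (hf l).convex_equilibriumSet hCconv)).inter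
          (convex_iInter fun k => (hg k).convex_equilibriumSet hCconv)
  have hCanti : Antitone Cset := antitone_nat_of_succ_le fun n => by
    rw [hCrec]; exact Set.sep_subset _ _
  have hCsetC : ∀ n, Cset n ⊆ C := fun n => hC0 ▸ hCanti (Nat.zero_le n)
  have hCsetconv : ∀ n, Convex ℝ (Cset n) := by
    intro n
    induction n with
    | zero => rwa [hC0]
    | succ n ih => rw [hCrec]; exact ih.inter (convex_setOf_norm_sub_le_norm_sub _ _)
  have hxproj : ∀ n, xseq n ∈ Cset n ∧ ∀ w ∈ Cset n, ‖x - xseq n‖ ≤ ‖x - w‖ := by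
    rintro (_ | n)
    · rw [hx0, hC0]; exact ⟨hx, fun w _ => by simp⟩
    · exact hxnext n
  have hest : ∀ n, ∀ q ∈ B, α₂ * ‖xseq n - zseq n‖ ^ 2 + α₃ * ‖xseq n - useq n‖ ^ 2 ≤
      ‖xseq n - q‖ ^ 2 - ‖yseq n - q‖ ^ 2 := by
    intro n q hq
    obtain ⟨⟨hq1, hq2⟩, hq3⟩ := (hBmem q).1 hq
    have hzq := (hf _).norm_sq_add_norm_sq_le (hrpos n) (hzres n) (hq2 _)
    have huq := (hg _).norm_sq_add_norm_sq_le (hrpos n) (hures n) (hq3 _)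
    have hqT : q ∈ C ∧ T n q = q := Set.mem_iInter.1 (hcommon ▸ hq1) n
    have hTq := hTnonexp n _ (hures n).1 q hqT.1
    rw [hqT.2] at hTq
    have hTq2 := pow_le_pow_left₀ (norm_nonneg _) hTq 2
    have hy : yseq n - q =
        α₁ • (xseq n - q) + α₂ • (zseq n - q) + α₃ • (T n (useq n) - q) := by
      rw [hyseq]
      obtain rfl : α₁ = 1 - α₂ - α₃ := by linarith
      module
    have hc := norm_smul_add_smul_add_smul_sq_le (xseq n - q) (zseq n - q) (T n (useq n) - q)
      hα₁.1.le hα₂.1.le hα₃.1.le hαsum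
    rw [← hy] at hc
    have h2 := mul_le_mul_of_nonneg_left hzq hα₂.1.le
    have h3 := mul_le_mul_of_nonneg_left (huq.trans' (add_le_add_left hTq2 _)) hα₃.1.le
    have h4 : ‖xseq n - q‖ ^ 2 = α₁ * ‖xseq n - q‖ ^ 2 + α₂ * ‖xseq n - q‖ ^ 2 +
        α₃ * ‖xseq n - q‖ ^ 2 := by rw [← add_mul, ← add_mul, hαsum, one_mul]
    linarith
  have hBsub : ∀ n, B ⊆ Cset n := by
    intro n q hq
    induction n with
    | zero => rw [hC0]; exact (((hBmem q).1 hq).1.2 ⟨0, hL⟩).1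
    | succ n ih =>
      rw [hCrec]
      refine ⟨ih, ?_⟩
      rw [norm_sub_rev q, norm_sub_rev q]
      refine le_of_sq_le_sq ?_ (norm_nonneg _)
      have h1 := mul_nonneg hα₂.1.le (sq_nonneg ‖xseq n - zseq n‖)
      have h2 := mul_nonneg hα₃.1.le (sq_nonneg ‖xseq n - useq n‖)
      linarith [hest n q hq]
  obtain ⟨b, hb⟩ := hBne
  obtain ⟨p, hxp⟩ := cauchySeq_tendsto_of_complete
    (cauchySeq_of_antitone_of_forall_norm_sub_le hCanti hCsetconv (fun n => hBsub n hb)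
      (fun n => (hxproj n).1) (fun n => (hxproj n).2))
  have hpC : p ∈ C :=
    hCclosed.mem_of_tendsto hxp (Eventually.of_forall fun n => hCsetC n (hxproj n).1)
  have hxp1 : Tendsto (fun n => xseq (n + 1)) atTop (𝓝 p) :=
    hxp.comp (tendsto_add_atTop_nat 1)
  have hyp : Tendsto yseq atTop (𝓝 p) := by
    have h0 : Tendsto (fun n => ‖xseq (n + 1) - xseq n‖) atTop (𝓝 0) := by
      simpa using (hxp1.sub hxp).norm
    have h1 : Tendsto (fun n => xseq (n + 1) - yseq n) atTop (𝓝 0) := by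
      refine squeeze_zero_norm (fun n => ?_) h0
      have := (hxnext n).1
      rw [hCrec] at this
      exact this.2
    simpa using hxp1.sub h1
  have hgap : Tendsto (fun n => ‖xseq n - b‖ ^ 2 - ‖yseq n - b‖ ^ 2) atTop (𝓝 0) := by
    simpa using ((hxp.sub_const b).norm.pow 2).sub ((hyp.sub_const b).norm.pow 2)
  have hzp : Tendsto zseq atTop (𝓝 p) := by
    have := tendsto_zero_of_mul_norm_sq_le (v := fun n => xseq n - zseq n) hα₂.1 hgap fun n => by
      linarith [hest n b hb, mul_nonneg hα₃.1.le (sq_nonneg ‖xseq n - useq n‖)]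
    simpa using hxp.sub this
  have hup : Tendsto useq atTop (𝓝 p) := by
    have := tendsto_zero_of_mul_norm_sq_le (v := fun n => xseq n - useq n) hα₃.1 hgap fun n => by
      linarith [hest n b hb, mul_nonneg hα₂.1.le (sq_nonneg ‖xseq n - zseq n‖)]
    simpa using hxp.sub this
  have hTu : Tendsto (fun n => T n (useq n)) atTop (𝓝 p) := by
    have h1 := ((hyp.sub (hxp.const_smul α₁)).sub (hzp.const_smul α₂)).const_smul α₃⁻¹
    have h2 : α₃⁻¹ • (p - α₁ • p - α₂ • p) = p := by
      rw [inv_smul_eq_iff₀ hα₃.1.ne']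
      obtain rfl : α₁ = 1 - α₂ - α₃ := by linarith
      module
    rw [h2] at h1
    refine h1.congr fun n => ?_
    rw [inv_smul_eq_iff₀ hα₃.1.ne', hyseq]
    abel
  have hpΓ : p ∈ FΓ := by
    rw [hFΓ]
    refine ⟨hpC, fun S hS => ?_⟩
    have h1 : Tendsto (fun n => ‖useq n - T n (useq n)‖) atTop (𝓝 0) := by
      simpa using (hup.sub hTu).norm
    have h2 := hNST useq (fun n => (hures n).1) (Metric.isBounded_range_of_tendsto _ hup) h1 S hS
    have h3 := hup.sub (tendsto_zero_iff_norm_tendsto_zero.2 h2)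
    exact hΓclosed S hS useq (fun n => (hures n).1) p hpC hup p (by simpa using h3)
  refine ⟨p, (hBmem p).2 ⟨⟨hpΓ, fun l => ?_⟩, fun k => ?_⟩, fun w hw => ?_, hxp⟩
  · have hsub := tendsto_add_mul_atTop l hL
    refine (hf l).mem_equilibriumSet_of_tendsto hCconv ha (fun i => hrn (l + i * L))
      (fun i => ?_) hpC (hxp.comp hsub) (hzp.comp hsub)
    have h := hzres (l + i * L)
    simp only [Nat.add_mul_mod_self_right, Nat.mod_eq_of_lt l.2] at h
    exact h
  · have hsub := tendsto_add_mul_atTop k hN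
    refine (hg k).mem_equilibriumSet_of_tendsto hCconv ha (fun i => hrn (k + i * N))
      (fun i => ?_) hpC (hxp.comp hsub) (hup.comp hsub)
    have h := hures (k + i * N)
    simp only [Nat.add_mul_mod_self_right, Nat.mod_eq_of_lt k.2] at h
    exact h
  · exact le_of_tendsto (tendsto_const_nhds.sub hxp).norm
      (Eventually.of_forall fun n => (hxproj n).2 w (hBsub n hw))
end
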